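/- Let R be a Noetherian ring and M an Artinian R-module. Then the flat dimension of M equals sup over maximal ideals m of the flat dimension of the R_m-module Hom_R(R_m, M): fd_R(M) = sup{fd_{R_m}(Hom_R(R_m, M)) | m ∈ Max(R)}. -/

import Mathlib

universe u

open CategoryTheory

/-- The flat dimension of a module `N` over `A`: the least `n` such that `Tor_{n+1}(P, N) = 0`
for all `A`-modules `P` (and `∞` if there is no such `n`). -/
noncomputable def flatDim (A : Type u) [CommRing A] (N : Type u) [AddCommGroup N]
    [Module A N] : ℕ∞ :=
  sInf {n : ℕ∞ | ∃ k : ℕ, (k : ℕ∞) = n ∧ ∀ P : ModuleCat.{u} A,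
    Limits.IsZero (((Tor (ModuleCat.{u} A) (k + 1)).obj P).obj (ModuleCat.of A N))}

section

variable {R : Type*} [CommRing R] {M : Type*} [AddCommGroup M] [Module R M]
  (p : Ideal R) [p.IsPrime]

/-- The `R_p`-module structure on the co-localization `Hom_R(R_p, M)`, where `a ∈ R_p` acts by
precomposition with multiplication by `a`. -/
noncomputable instance colocalizationModule :
    Module (Localization.AtPrime p) (Localization.AtPrime p →ₗ[R] M) where
  smul a f := f.comp (LinearMap.mulLeft R a)
  one_smul f := LinearMap.ext fun y => by show f (1 * y) = f y; rw [one_mul]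
  mul_smul a b f := LinearMap.ext fun y => by
    show f (a * b * y) = f (b * (a * y)); congr 1; ring
  smul_zero a := LinearMap.ext fun y => rfl
  smul_add a f g := LinearMap.ext fun y => rfl
  add_smul a b f := LinearMap.ext fun y => by
    show f ((a + b) * y) = f (a * y) + f (b * y); rw [add_mul, map_add]
  zero_smul f := LinearMap.ext fun y => by
    show f (0 * y) = 0; rw [zero_mul, map_zero]

end


section LinearCompactness

/-- Finite intersection property for families of affine subspaces. -/
def AffFIP {R X : Type*} [Ring R] [AddCommGroup X] [Module R X]
    (C : Set (AffineSubspace R X)) : Prop :=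
  ∀ t ⊆ C, t.Finite → ∃ x : X, ∀ c ∈ t, x ∈ c

theorem AffFIP.exists_maximal {R X : Type*} [Ring R] [AddCommGroup X] [Module R X]
    {C : Set (AffineSubspace R X)} (h : AffFIP C) :
    ∃ D : Set (AffineSubspace R X), C ⊆ D ∧ AffFIP D ∧
      ∀ E, D ⊆ E → AffFIP E → E ⊆ D := by
  have hF : Order.IsOfFiniteCharacter {C : Set (AffineSubspace R X) | AffFIP C} := by
    intro C
    constructor
    · intro h y hy _ t ht htf
      exact h t (ht.trans hy) htf
    · intro h t ht htf
      exact h t ht htf t subset_rfl htf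
  obtain ⟨D, h1, h2⟩ := hF.exists_maximal h
  exact ⟨D, h1, h2.1, fun E hE hE' => h2.2 hE' hE⟩

theorem AffFIP.exists_coord {R B ι : Type*} [Ring R] [AddCommGroup B] [Module R B]
    [IsArtinian R B] {D : Set (AffineSubspace R (ι → B))} (h : AffFIP D)
    (hmax : ∀ E, D ⊆ E → AffFIP E → E ⊆ D) (i : ι) :
    ∃ a : B, (AffineSubspace.mk' a (⊥ : Submodule R B)).comap
      (LinearMap.proj (R := R) (φ := fun _ : ι => B) i).toAffineMap ∈ D := by
  classical
  let pr := (LinearMap.proj (R := R) (φ := fun _ : ι => B) i).toAffineMap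
  let W : Set (Submodule R B) := {N | ∃ t ⊆ D, t.Finite ∧ N = ((sInf t).map pr).direction}
  have hW : W.Nonempty := ⟨_, ∅, Set.empty_subset _, Set.finite_empty, rfl⟩
  obtain ⟨N, ⟨t0, ht0, ht0f, rfl⟩, hmin⟩ :=
    (set_has_minimal_iff_artinian (R := R) (M := B)).2 inferInstance W hW
  obtain ⟨x0, hx0⟩ := h t0 ht0 ht0f
  have hx0' : x0 ∈ sInf t0 := by simpa [AffineSubspace.mem_sInf_iff] using hx0
  refine ⟨x0 i, ?_⟩
  refine hmax (insert _ D) (Set.subset_insert _ _) ?_ (Set.mem_insert _ _)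
  intro t ht htf
  let t' : Set (AffineSubspace R (ι → B)) := (t ∩ D) ∪ t0
  have ht' : t' ⊆ D := Set.union_subset Set.inter_subset_right ht0
  have ht'f : t'.Finite := (htf.subset Set.inter_subset_left).union ht0f
  obtain ⟨x1, hx1⟩ := h t' ht' ht'f
  have hx1' : x1 ∈ sInf t' := by simpa [AffineSubspace.mem_sInf_iff] using hx1
  have hle : (sInf t').map pr ≤ (sInf t0).map pr :=
    AffineSubspace.map_mono _ (sInf_le_sInf Set.subset_union_right)
  have hdir : ((sInf t').map pr).direction = ((sInf t0).map pr).direction := by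
    by_contra hne
    exact hmin _ ⟨t', ht', ht'f, rfl⟩ (lt_of_le_of_ne (AffineSubspace.direction_le hle) hne)
  have heq : (sInf t').map pr = (sInf t0).map pr :=
    AffineSubspace.eq_of_direction_eq_of_nonempty_of_le hdir
      ⟨pr x1, AffineSubspace.mem_map_of_mem _ hx1'⟩ hle
  have hm : pr x0 ∈ (sInf t').map pr := heq ▸ AffineSubspace.mem_map_of_mem _ hx0'
  obtain ⟨x, hx, hxi⟩ := (AffineSubspace.mem_map).1 hm
  rw [AffineSubspace.mem_sInf_iff] at hx
  refine ⟨x, fun c hc => ?_⟩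
  rcases ht hc with rfl | hcD
  · rw [AffineSubspace.mem_comap]
    change pr x ∈ _
    rw [hxi]
    exact AffineSubspace.self_mem_mk' _ _
  · exact hx c (Or.inl ⟨hc, hcD⟩)

/-- Linear compactness of products of Artinian modules. -/
theorem AffFIP.exists_point {R B ι : Type*} [Ring R] [AddCommGroup B] [Module R B]
    [IsArtinian R B] {C : Set (AffineSubspace R (ι → B))} (h : AffFIP C)
    (hfin : ∀ c ∈ C, ∃ T : Set ι, T.Finite ∧ ∀ x y : ι → B, (∀ i ∈ T, x i = y i) →
      x ∈ c → y ∈ c) : ∃ g : ι → B, ∀ c ∈ C, g ∈ c := by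
  obtain ⟨D, hCD, hD, hmax⟩ := h.exists_maximal
  choose g hg using fun i => hD.exists_coord hmax i
  refine ⟨g, fun c hc => ?_⟩
  obtain ⟨T, hT, hdep⟩ := hfin c hc
  obtain ⟨x, hx⟩ := hD (insert c ((fun i => (AffineSubspace.mk' (g i) (⊥ : Submodule R B)).comap
      (LinearMap.proj (R := R) (φ := fun _ : ι => B) i).toAffineMap) '' T))
    (by
      intro d hd
      rcases hd with rfl | ⟨i, _, rfl⟩
      · exact hCD hc
      · exact hg i) ((hT.image _).insert _)
  refine hdep x g (fun i hi => ?_) (hx c (Set.mem_insert _ _))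
  have := hx _ (Set.mem_insert_of_mem _ ⟨i, hi, rfl⟩)
  rw [AffineSubspace.mem_comap, AffineSubspace.mem_mk'] at this
  simpa [sub_eq_zero] using this

/-- the constraint of additivity -/
def addConstraint {R B L : Type*} [CommRing R] [AddCommGroup B] [Module R B]
    [AddCommGroup L] [Module R L] (c : R × L × L) : AffineSubspace R (L → B) where
  carrier := {g | g (c.1 • c.2.1 + c.2.2) = c.1 • g c.2.1 + g c.2.2}
  smul_vsub_vadd_mem' := by
    intro a x y z hx hy hz
    simp only [Set.mem_ofPred_eq, vsub_eq_sub, vadd_eq_add, Pi.add_apply, Pi.smul_apply,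
      Pi.sub_apply] at *
    rw [hx, hy, hz]
    module

/-- the constraint of lifting -/
def liftConstraint {R B L C : Type*} [CommRing R] [AddCommGroup B] [Module R B]
    [AddCommGroup C] [Module R C]
    (π : B →ₗ[R] C) (f : L → C) (l : L) : AffineSubspace R (L → B) where
  carrier := {g | π (g l) = f l}
  smul_vsub_vadd_mem' := by
    intro a x y z hx hy hz
    simp only [Set.mem_ofPred_eq, vsub_eq_sub, vadd_eq_add, Pi.add_apply, Pi.smul_apply,
      Pi.sub_apply] at *
    simp [hx, hy, hz]

theorem exists_lift_of_artinian {R L B C : Type*} [CommRing R] (S : Submonoid R)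
    [CommRing L] [Algebra R L] [IsLocalization S L]
    [AddCommGroup B] [Module R B] [IsArtinian R B] [AddCommGroup C] [Module R C]
    (π : B →ₗ[R] C) (f : L →ₗ[R] C) (hf : ∀ l, f l ∈ LinearMap.range π) :
    ∃ g : L →ₗ[R] B, ∀ l, π (g l) = f l := by
  classical
  have key : AffFIP (Set.range (addConstraint (R := R) (B := B) (L := L)) ∪
      Set.range (liftConstraint π f)) := by
    intro t ht htf
    have hφ : ∀ c ∈ t, ∃ i : (R × L × L) ⊕ L,
        Sum.elim (addConstraint (R := R) (B := B) (L := L)) (liftConstraint π f) i = c := by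
      intro c hc
      rcases ht hc with ⟨i, rfl⟩ | ⟨l, rfl⟩
      · exact ⟨Sum.inl i, rfl⟩
      · exact ⟨Sum.inr l, rfl⟩
    choose! φ hφ using hφ
    let el : (R × L × L) ⊕ L → Finset L :=
      Sum.elim (fun c => {c.1 • c.2.1 + c.2.2, c.2.1, c.2.2}) (fun l => {l})
    let I : Finset ((R × L × L) ⊕ L) := htf.toFinset.image φ
    obtain ⟨s, hs⟩ := IsLocalization.exist_integer_multiples_of_finset S (I.biUnion el)
    have hs' : ∀ a ∈ I.biUnion el, ∃ n : R, algebraMap R L n = (s : R) • a := hs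
    choose! num hnum using hs'
    have hu : ∀ i ∈ I, ∃ u : S, ∀ c : R × L × L, i = Sum.inl c →
        (u : R) * num (c.1 • c.2.1 + c.2.2) = u * (c.1 * num c.2.1 + num c.2.2) := by
      rintro (⟨r, x, y⟩ | l) hi
      · have e1 := hnum (r • x + y) (Finset.mem_biUnion.2 ⟨_, hi, by simp [el]⟩)
        have e2 := hnum x (Finset.mem_biUnion.2 ⟨_, hi, by simp [el]⟩)
        have e3 := hnum y (Finset.mem_biUnion.2 ⟨_, hi, by simp [el]⟩)
        have : algebraMap R L (num (r • x + y)) = algebraMap R L (r * num x + num y) := by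
          rw [map_add, map_mul, e1, e2, e3]
          simp only [Algebra.smul_def]
          ring
        obtain ⟨u, hu⟩ := (IsLocalization.eq_iff_exists S L).1 this
        refine ⟨u, fun c hc => ?_⟩
        obtain rfl := Sum.inl.inj hc
        exact hu
      · exact ⟨1, fun c hc => by cases hc⟩
    choose! u hu using hu
    let U : S := ∏ i ∈ I, u i
    have hU : ∀ c : R × L × L, Sum.inl c ∈ I →
        (U : R) * num (c.1 • c.2.1 + c.2.2) = U * (c.1 * num c.2.1 + num c.2.2) := by
      intro c hc
      have hUe : U = (∏ i ∈ I.erase (Sum.inl c), u i) * u (Sum.inl c) :=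
        (Finset.prod_erase_mul _ _ hc).symm
      rw [hUe, Submonoid.coe_mul, mul_assoc, hu _ hc c rfl, mul_assoc]
    obtain ⟨b, hb⟩ := hf (IsLocalization.mk' L (1 : R) (s * U))
    refine ⟨fun x => ((U : R) * num x) • b, fun c hc => ?_⟩
    have hcI : φ c ∈ I := Finset.mem_image_of_mem _ (htf.mem_toFinset.2 hc)
    rw [← hφ c hc]
    rcases hi : φ c with d | l
    · rw [hi] at hcI
      change ((U : R) * num (d.1 • d.2.1 + d.2.2)) • b =
        d.1 • ((U : R) * num d.2.1) • b + ((U : R) * num d.2.2) • b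
      rw [hU d hcI]
      module
    · rw [hi] at hcI
      change π (((U : R) * num l) • b) = f l
      rw [map_smul, hb, ← map_smul]
      congr 1
      have e := hnum l (Finset.mem_biUnion.2 ⟨_, hcI, by simp [el]⟩)
      rw [Algebra.smul_def, ← IsLocalization.mk'_eq_mul_mk'_one, eq_comm,
        IsLocalization.eq_mk'_iff_mul_eq]
      rw [Submonoid.coe_mul, map_mul, map_mul, e, Algebra.smul_def]
      ring
  obtain ⟨g, hg⟩ := key.exists_point (by
    rintro c (⟨⟨r, x, y⟩, rfl⟩ | ⟨l, rfl⟩)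
    · refine ⟨{r • x + y, x, y}, by simp, fun g g' h hgm => ?_⟩
      have e1 := h (r • x + y) (by simp)
      have e2 := h x (by simp)
      have e3 := h y (by simp)
      change g' (r • x + y) = r • g' x + g' y
      rw [← e1, ← e2, ← e3]
      exact hgm
    · refine ⟨{l}, by simp, fun g g' h hgm => ?_⟩
      change π (g' l) = f l
      rw [← h l rfl]
      exact hgm)
  have hadd : ∀ (r : R) (x y : L), g (r • x + y) = r • g x + g y := fun r x y =>
    hg _ (Or.inl ⟨(r, x, y), rfl⟩)
  have h0 : g 0 = 0 := by simpa using hadd 1 0 0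
  exact ⟨{ toFun := g
           map_add' := fun x y => by simpa using hadd 1 x y
           map_smul' := fun r x => by simpa [h0] using hadd r x 0 },
    fun l => hg _ (Or.inr ⟨l, rfl⟩)⟩
end LinearCompactness

section FlatDimension

open TensorProduct

/-- Half of the balancing of `Tor₁`. -/
theorem balance_aux {R : Type*} [CommRing R] {K F N Q G P : Type*}
    [AddCommGroup K] [Module R K] [AddCommGroup F] [Module R F] [AddCommGroup N] [Module R N]
    [AddCommGroup Q] [Module R Q] [AddCommGroup G] [Module R G] [AddCommGroup P] [Module R P]
    (i : K →ₗ[R] F) (p : F →ₗ[R] N) (j : Q →ₗ[R] G) (q : G →ₗ[R] P)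
    (hip : Function.Exact i p) (hp : Function.Surjective p)
    (hjq : Function.Exact j q) (hq : Function.Surjective q)
    (hG : Function.Injective (i.lTensor G))
    (h : Function.Injective (j.rTensor N)) : Function.Injective (i.lTensor P) := by
  rw [injective_iff_map_eq_zero]
  intro x hx
  obtain ⟨y, rfl⟩ := LinearMap.rTensor_surjective K hq x
  have h1 : q.rTensor F (i.lTensor G y) = 0 := by
    rw [← hx, ← LinearMap.comp_apply, ← LinearMap.comp_apply, LinearMap.rTensor_comp_lTensor,
      LinearMap.lTensor_comp_rTensor]
  obtain ⟨z, hz⟩ := (rTensor_exact F hjq hq _).1 h1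
  have h2 : p.lTensor Q z = 0 := by
    apply h
    rw [map_zero, ← LinearMap.comp_apply, LinearMap.rTensor_comp_lTensor,
      ← LinearMap.lTensor_comp_rTensor, LinearMap.comp_apply, hz]
    exact (lTensor_exact G hip hp _).2 ⟨y, rfl⟩
  obtain ⟨w, rfl⟩ := (lTensor_exact Q hip hp _).1 h2
  have h3 : j.rTensor K w = y := by
    apply hG
    rw [← hz, ← LinearMap.comp_apply, ← LinearMap.comp_apply, LinearMap.rTensor_comp_lTensor,
      LinearMap.lTensor_comp_rTensor]
  rw [← h3]
  exact (rTensor_exact K hjq hq _).2 ⟨w, rfl⟩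

theorem balance {R : Type*} [CommRing R] {K F N Q G P : Type*}
    [AddCommGroup K] [Module R K] [AddCommGroup F] [Module R F] [AddCommGroup N] [Module R N]
    [AddCommGroup Q] [Module R Q] [AddCommGroup G] [Module R G] [AddCommGroup P] [Module R P]
    [Module.Flat R F] [Module.Flat R G]
    (i : K →ₗ[R] F) (p : F →ₗ[R] N) (j : Q →ₗ[R] G) (q : G →ₗ[R] P)
    (hi : Function.Injective i) (hip : Function.Exact i p) (hp : Function.Surjective p)
    (hj : Function.Injective j) (hjq : Function.Exact j q) (hq : Function.Surjective q) :
    Function.Injective (j.rTensor N) ↔ Function.Injective (i.lTensor P) := by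
  constructor
  · exact balance_aux i p j q hip hp hjq hq (Module.Flat.lTensor_preserves_injective_linearMap i hi)
  · intro h
    rw [LinearMap.lTensor_inj_iff_rTensor_inj] at h
    rw [← LinearMap.lTensor_inj_iff_rTensor_inj]
    exact balance_aux j q i p hjq hq hip hp
      (Module.Flat.lTensor_preserves_injective_linearMap j hj) h

/-- Vanishing of `Tor_{k+1}(P, N)`, computed by resolving `P` by finite free modules. -/
def TV (R : Type u) [CommRing R] (N : Type u) [AddCommGroup N] [Module R N] :
    ℕ → ∀ (P : Type u) [AddCommGroup P] [Module R P], Prop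
  | 0, P, _, _ => ∀ (G : Type u) [AddCommGroup G] [Module R G] [Module.Free R G]
      [Module.Finite R G] (f : G →ₗ[R] P), Function.Surjective f →
      Function.Injective ((LinearMap.ker f).subtype.rTensor N)
  | k + 1, P, _, _ => ∀ (G : Type u) [AddCommGroup G] [Module R G] [Module.Free R G]
      [Module.Finite R G] (f : G →ₗ[R] P), Function.Surjective f →
      TV R N k (LinearMap.ker f)

/-- All `Tor_{k+1}(P, N)` vanish for finite `P`. -/
def TFD (R : Type u) [CommRing R] (N : Type u) [AddCommGroup N] [Module R N] (k : ℕ) : Prop :=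
  ∀ (P : Type u) [AddCommGroup P] [Module R P] [Module.Finite R P], TV R N k P

theorem exists_finite_free_cover (R : Type u) [CommRing R] (P : Type u) [AddCommGroup P]
    [Module R P] [Module.Finite R P] : ∃ n : ℕ, ∃ f : (Fin n → R) →ₗ[R] P,
      Function.Surjective f := Module.Finite.exists_fin' R P

theorem TV_shift {R : Type u} [CommRing R] [IsNoetherianRing R] {K F N : Type u}
    [AddCommGroup K] [Module R K] [AddCommGroup F] [Module R F] [AddCommGroup N] [Module R N]
    [Module.Flat R F] (i : K →ₗ[R] F) (p : F →ₗ[R] N)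
    (hi : Function.Injective i) (hip : Function.Exact i p) (hp : Function.Surjective p)
    (k : ℕ) (P : Type u) [AddCommGroup P] [Module R P] [Module.Finite R P] :
    TV R N (k + 1) P ↔ TV R K k P := by
  induction k generalizing P with
  | zero =>
    have key : ∀ (G : Type u) [AddCommGroup G] [Module R G] [Module.Free R G]
        [Module.Finite R G] (f : G →ₗ[R] P), Function.Surjective f →
        (Function.Injective (i.lTensor (LinearMap.ker f)) ↔
          Function.Injective ((LinearMap.ker f).subtype.rTensor K)) := by
      intro G _ _ _ _ f hf
      have e : (LinearMap.ker f).subtype.rTensor F ∘ₗ i.lTensor (LinearMap.ker f) =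
          i.lTensor G ∘ₗ (LinearMap.ker f).subtype.rTensor K := by
        rw [LinearMap.rTensor_comp_lTensor, LinearMap.lTensor_comp_rTensor]
      have h1 : Function.Injective ((LinearMap.ker f).subtype.rTensor F) :=
        Module.Flat.rTensor_preserves_injective_linearMap _ Subtype.val_injective
      have h2 : Function.Injective (i.lTensor G) :=
        Module.Flat.lTensor_preserves_injective_linearMap _ hi
      rw [← h1.of_comp_iff, ← h2.of_comp_iff, ← LinearMap.coe_comp, ← LinearMap.coe_comp, e]
    have bal : ∀ (G : Type u) [AddCommGroup G] [Module R G] [Module.Free R G]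
        [Module.Finite R G] (f : G →ₗ[R] P) (G' : Type u) [AddCommGroup G'] [Module R G']
        [Module.Free R G'] [Module.Finite R G'] (g : G' →ₗ[R] LinearMap.ker f),
        Function.Surjective g → (Function.Injective ((LinearMap.ker g).subtype.rTensor N) ↔
          Function.Injective (i.lTensor (LinearMap.ker f))) := by
      intro G _ _ _ _ f G' _ _ _ _ g hg
      exact balance i p (LinearMap.ker g).subtype g hi hip hp Subtype.val_injective
        (LinearMap.exact_subtype_ker_map g) hg
    constructor
    · intro h G _ _ _ _ f hf
      obtain ⟨n, g, hg⟩ := exists_finite_free_cover R (LinearMap.ker f)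
      exact (key G f hf).1 ((bal G f _ g hg).1 (h G f hf _ g hg))
    · intro h G _ _ _ _ f hf G' _ _ _ _ g hg
      exact (bal G f G' g hg).2 ((key G f hf).2 (h G f hf))
  | succ k ih =>
    constructor
    · intro h G _ _ _ _ f hf
      exact (ih (LinearMap.ker f)).1 (h G f hf)
    · intro h G _ _ _ _ f hf
      exact (ih (LinearMap.ker f)).2 (h G f hf)

theorem TFD_shift {R : Type u} [CommRing R] [IsNoetherianRing R] {K F N : Type u}
    [AddCommGroup K] [Module R K] [AddCommGroup F] [Module R F] [AddCommGroup N] [Module R N]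
    [Module.Flat R F] (i : K →ₗ[R] F) (p : F →ₗ[R] N)
    (hi : Function.Injective i) (hip : Function.Exact i p) (hp : Function.Surjective p)
    (k : ℕ) : TFD R N (k + 1) ↔ TFD R K k :=
  forall_congr' fun P => forall_congr' fun _ => forall_congr' fun _ => forall_congr' fun _ =>
    TV_shift i p hi hip hp k P

theorem TFD_succ {R : Type u} [CommRing R] [IsNoetherianRing R] {N : Type u}
    [AddCommGroup N] [Module R N] {k : ℕ} (h : TFD R N k) : TFD R N (k + 1) := by
  intro P _ _ _ G _ _ _ _ f hf
  exact h (LinearMap.ker f)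

theorem TFD_mono {R : Type u} [CommRing R] [IsNoetherianRing R] {N : Type u}
    [AddCommGroup N] [Module R N] {k l : ℕ} (hkl : k ≤ l) (h : TFD R N k) : TFD R N l := by
  induction hkl with
  | refl => exact h
  | step _ ih => exact TFD_succ ih

theorem TFD_zero_iff {R : Type u} [CommRing R] {N : Type u}
    [AddCommGroup N] [Module R N] : TFD R N 0 ↔ Module.Flat R N := by
  constructor
  · intro h
    rw [Module.Flat.iff_rTensor_injective']
    intro I
    have := h (R ⧸ I) R I.mkQ (Submodule.mkQ_surjective I)
    rwa [Submodule.ker_mkQ] at this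
  · intro h P _ _ _ G _ _ _ _ f hf
    exact Module.Flat.rTensor_preserves_injective_linearMap _ Subtype.val_injective

/-- For modules over a localization, the dimension may be computed over either ring. -/
theorem TFD_iff_localization {R : Type u} [CommRing R] [IsNoetherianRing R] (S : Submonoid R)
    (A : Type u) [CommRing A] [IsNoetherianRing A] [Algebra R A] [IsLocalization S A] (k : ℕ)
    (N : Type u) [AddCommGroup N] [Module R N] [Module A N] [IsScalarTower R A N] :
    TFD A N k ↔ TFD R N k := by
  induction k generalizing N with
  | zero =>
    rw [TFD_zero_iff, TFD_zero_iff]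
    exact Module.flat_iff_of_isLocalization A S N
  | succ k ih =>
    let p : (N →₀ A) →ₗ[A] N := Finsupp.linearCombination A id
    have hp : Function.Surjective p := Finsupp.linearCombination_id_surjective A N
    have e := LinearMap.exact_subtype_ker_map p
    have hfl : Module.Flat R (N →₀ A) :=
      (Module.flat_iff_of_isLocalization A S (N →₀ A)).1 inferInstance
    have h1 : TFD A N (k + 1) ↔ TFD A (LinearMap.ker p) k :=
      TFD_shift (R := A) (LinearMap.ker p).subtype p (Submodule.subtype_injective _) e hp k
    rw [h1, ih]
    exact (TFD_shift (R := R) ((LinearMap.ker p).subtype.restrictScalars R) (p.restrictScalars R)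
      (Submodule.subtype_injective _) e hp k).symm

end FlatDimension

section TorComparison

open TensorProduct

theorem TFD_zero_iff_res {R : Type u} [CommRing R] {N F0 F1 F2 : Type u}
    [AddCommGroup N] [Module R N] [AddCommGroup F0] [Module R F0]
    [AddCommGroup F1] [Module R F1] [AddCommGroup F2] [Module R F2]
    [Module.Flat R F0] (d0 : F1 →ₗ[R] F0) (d1 : F2 →ₗ[R] F1) (p : F0 →ₗ[R] N)
    (hp : Function.Surjective p) (h0 : Function.Exact d0 p) (h1 : Function.Exact d1 d0) :
    TFD R N 0 ↔ ∀ (P : Type u) [AddCommGroup P] [Module R P],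
      Function.Exact (d1.lTensor P) (d0.lTensor P) := by
  let i := (LinearMap.range d0).subtype
  let r := d0.rangeRestrict
  have hr : Function.Surjective r := d0.surjective_rangeRestrict
  have hir : i ∘ₗ r = d0 := by ext; rfl
  have hi : Function.Injective i := Submodule.subtype_injective _
  have hip : Function.Exact i p := by
    intro x
    rw [h0 x]
    simp [i]
  have h1r : Function.Exact d1 r := by
    intro x
    rw [← h1 x]
    exact Subtype.ext_iff
  have A : ∀ (P : Type u) [AddCommGroup P] [Module R P],
      (Function.Exact (d1.lTensor P) (d0.lTensor P) ↔ Function.Injective (i.lTensor P)) := by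
    intro P _ _
    have hex := lTensor_exact P h1r hr
    have hsu := LinearMap.lTensor_surjective P hr
    have hc : ∀ y, d0.lTensor P y = i.lTensor P (r.lTensor P y) := by
      intro y
      rw [← LinearMap.comp_apply, ← LinearMap.lTensor_comp, hir]
    constructor
    · intro h
      rw [injective_iff_map_eq_zero]
      intro x hx
      obtain ⟨y, rfl⟩ := hsu x
      rw [← hc] at hx
      exact (hex y).2 ((h y).1 hx)
    · intro h y
      rw [hc, map_eq_zero_iff _ h]
      exact hex y
  constructor
  · intro h P _ _
    rw [A P]
    have hfl := TFD_zero_iff.1 h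
    obtain ⟨G, _, _, _, q, hq⟩ : ∃ (G : Type u) (_ : AddCommGroup G) (_ : Module R G)
        (_ : Module.Flat R G) (q : G →ₗ[R] P), Function.Surjective q :=
      ⟨P →₀ R, inferInstance, inferInstance, inferInstance, Finsupp.linearCombination R id,
        Finsupp.linearCombination_id_surjective R P⟩
    have hj : Function.Injective ((LinearMap.ker q).subtype.rTensor N) :=
      Module.Flat.rTensor_preserves_injective_linearMap _ (Submodule.subtype_injective _)
    exact (balance (R := R) i p (LinearMap.ker q).subtype q hi hip hp
      (Submodule.subtype_injective _) (LinearMap.exact_subtype_ker_map q) hq).1 hj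
  · intro h P _ _ _ G _ _ _ _ f hf
    exact (balance i p (LinearMap.ker f).subtype f hi hip hp (Submodule.subtype_injective _)
      (LinearMap.exact_subtype_ker_map f) hf).2 ((A P).1 (h P))

theorem TFD_iff_res {R : Type u} [CommRing R] [IsNoetherianRing R] (k : ℕ) (N : Type u)
    [AddCommGroup N] [Module R N] (F : ℕ → Type u) [∀ n, AddCommGroup (F n)]
    [∀ n, Module R (F n)] [∀ n, Module.Flat R (F n)] (d : ∀ n, F (n + 1) →ₗ[R] F n)
    (p : F 0 →ₗ[R] N) (hp : Function.Surjective p) (h0 : Function.Exact (d 0) p)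
    (hd : ∀ n, Function.Exact (d (n + 1)) (d n)) :
    TFD R N k ↔ ∀ (P : Type u) [AddCommGroup P] [Module R P],
      Function.Exact ((d (k + 1)).lTensor P) ((d k).lTensor P) := by
  induction k generalizing N F with
  | zero => exact TFD_zero_iff_res (d 0) (d 1) p hp h0 (hd 0)
  | succ k ih =>
    have hip : Function.Exact (LinearMap.range (d 0)).subtype p := by
      intro x
      rw [h0 x]
      simp
    rw [TFD_shift (R := R) (LinearMap.range (d 0)).subtype p (Submodule.subtype_injective _)
      hip hp k]
    refine ih (LinearMap.range (d 0)) (fun n => F (n + 1)) (fun n => d (n + 1))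
      (d 0).rangeRestrict (d 0).surjective_rangeRestrict ?_ (fun n => hd (n + 1))
    intro x
    rw [← hd 0 x]
    exact Subtype.ext_iff

theorem isZero_Tor_iff {A : Type u} [CommRing A] {Z : ModuleCat.{u} A}
    (Pr : ProjectiveResolution Z) (P : ModuleCat.{u} A) (k : ℕ) :
    Limits.IsZero (((Tor (ModuleCat.{u} A) (k + 1)).obj P).obj Z) ↔
      Function.Exact ((Pr.complex.d (k + 1 + 1) (k + 1)).hom.lTensor P)
        ((Pr.complex.d (k + 1) k).hom.lTensor P) := by
  have e := Pr.isoLeftDerivedObj ((MonoidalCategory.tensoringLeft (ModuleCat.{u} A)).obj P) (k + 1)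
  rw [Tor_obj, e.isZero_iff]
  change Limits.IsZero (HomologicalComplex.homology _ (k + 1)) ↔ _
  rw [← HomologicalComplex.exactAt_iff_isZero_homology,
    HomologicalComplex.exactAt_iff' _ (k + 2) (k + 1) k (by simp only [ChainComplex.prev]; rfl)
    (by simp), ShortComplex.moduleCat_exact_iff_range_eq_ker, LinearMap.exact_iff]
  exact eq_comm

theorem flat_of_projective_obj {A : Type u} [CommRing A] (X : ModuleCat.{u} A) [Projective X] :
    Module.Flat A X := by
  have : Module.Projective A X := (IsProjective.iff_projective X).2 inferInstance
  infer_instance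

theorem Tor_vanish_iff_TFD {A : Type u} [CommRing A] [IsNoetherianRing A] (N : Type u)
    [AddCommGroup N] [Module A N] (k : ℕ) :
    (∀ P : ModuleCat.{u} A,
      Limits.IsZero (((Tor (ModuleCat.{u} A) (k + 1)).obj P).obj (ModuleCat.of A N))) ↔
      TFD A N k := by
  let Pr : ProjectiveResolution (ModuleCat.of A N) := projectiveResolution _
  simp_rw [isZero_Tor_iff Pr]
  have hfl : ∀ n, Module.Flat A (Pr.complex.X n) := fun n => flat_of_projective_obj _
  let p : Pr.complex.X 0 →ₗ[A] N := (Pr.π.f 0).hom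
  have hp : Function.Surjective p :=
    (ModuleCat.epi_iff_surjective (Pr.π.f 0)).1 inferInstance
  have h0 : Function.Exact (Pr.complex.d 1 0).hom p := by
    have := (ShortComplex.moduleCat_exact_iff_range_eq_ker _).1 Pr.exact₀
    exact LinearMap.exact_iff.2 this.symm
  have hd : ∀ n, Function.Exact (Pr.complex.d (n + 1 + 1) (n + 1)).hom
      (Pr.complex.d (n + 1) n).hom := by
    intro n
    have := (ShortComplex.moduleCat_exact_iff_range_eq_ker _).1 (Pr.exact_succ n)
    exact LinearMap.exact_iff.2 this.symm
  rw [TFD_iff_res k N (fun n => Pr.complex.X n) (fun n => (Pr.complex.d (n + 1) n).hom) p hp h0 hd]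
  exact ⟨fun h P _ _ => h (ModuleCat.of A P), fun h P => h P⟩

theorem flatDim_le_iff {A : Type u} [CommRing A] [IsNoetherianRing A] (N : Type u)
    [AddCommGroup N] [Module A N] (k : ℕ) : flatDim A N ≤ k ↔ TFD A N k := by
  unfold flatDim
  simp_rw [Tor_vanish_iff_TFD]
  constructor
  · intro h
    have hne : {n : ℕ∞ | ∃ j : ℕ, (j : ℕ∞) = n ∧ TFD A N j}.Nonempty := by
      by_contra hcon
      rw [Set.not_nonempty_iff_eq_empty] at hcon
      rw [hcon, sInf_empty] at h
      exact absurd h (by simp)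
    obtain ⟨j, hj, hT⟩ := csInf_mem hne
    rw [← hj] at h
    exact TFD_mono (by exact_mod_cast h) hT
  · intro h
    exact sInf_le ⟨k, rfl, h⟩

end TorComparison

section Colocalization

open TensorProduct

/-- The canonical map `Q ⊗ Hom(L, M) → Hom(L, Q ⊗ M)`. -/
noncomputable abbrev canMap (R L Q M : Type*) [CommRing R] [AddCommGroup L] [Module R L]
    [AddCommGroup Q] [Module R Q] [AddCommGroup M] [Module R M] :
    Q ⊗[R] (L →ₗ[R] M) →ₗ[R] (L →ₗ[R] Q ⊗[R] M) :=
  TensorProduct.lTensorHomToHomLTensor (.id R) L Q M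

theorem canMap_naturality {R L Q Q' M : Type*} [CommRing R] [AddCommGroup L] [Module R L]
    [AddCommGroup Q] [Module R Q] [AddCommGroup Q'] [Module R Q'] [AddCommGroup M] [Module R M]
    (j : Q →ₗ[R] Q') (x : Q ⊗[R] (L →ₗ[R] M)) :
    canMap R L Q' M (j.rTensor _ x) = (j.rTensor M) ∘ₗ canMap R L Q M x := by
  induction x with
  | zero => simp
  | add x y hx hy => simp only [map_add, hx, hy, LinearMap.comp_add]
  | tmul q f => ext l; simp [canMap]

theorem canMap_bijective_free {R L G M : Type*} [CommRing R] [AddCommGroup L] [Module R L]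
    [AddCommGroup G] [Module R G] [AddCommGroup M] [Module R M] [Module.Free R G]
    [Module.Finite R G] : Function.Bijective (canMap R L G M) := by
  let b := Module.Free.chooseBasis R G
  have key : ∀ (x : G ⊗[R] (L →ₗ[R] M)) i l,
      equivFinsuppOfBasisLeft b (canMap R L G M x l) i = equivFinsuppOfBasisLeft b x i l := by
    intro x i l
    induction x with
    | zero => simp
    | add x y hx hy => simp only [map_add, LinearMap.add_apply, Finsupp.add_apply, hx, hy]
    | tmul q f => simp [canMap, equivFinsuppOfBasisLeft_apply_tmul_apply]
  constructor
  · rw [injective_iff_map_eq_zero]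
    intro x hx
    apply (equivFinsuppOfBasisLeft b).injective
    ext i l
    rw [← key, hx]
    simp
  · intro h
    refine ⟨∑ i, b i ⊗ₜ (Finsupp.lapply i ∘ₗ (equivFinsuppOfBasisLeft (N := M) b).toLinearMap ∘ₗ h),
      ?_⟩
    ext l
    rw [map_sum, LinearMap.sum_apply]
    apply (equivFinsuppOfBasisLeft b).injective
    ext i
    classical
    simp [canMap, equivFinsuppOfBasisLeft_apply_tmul_apply, Finsupp.single_apply]

theorem isArtinian_tensor {R Q M : Type*} [CommRing R] 
    [AddCommGroup Q] [Module R Q] [AddCommGroup M] [Module R M] [Module.Finite R Q]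
    [IsArtinian R M] : IsArtinian R (Q ⊗[R] M) := by
  obtain ⟨n, f, hf⟩ := Module.Finite.exists_fin' R Q
  have : IsArtinian R ((Fin n → R) ⊗[R] M) :=
    isArtinian_of_linearEquiv ((TensorProduct.comm R _ _).trans
      (TensorProduct.piScalarRight R R M (Fin n))).symm
  exact isArtinian_of_surjective _ (f.rTensor M) (LinearMap.rTensor_surjective M hf)

theorem canMap_bijective {R L Q M : Type u} [CommRing R] [IsNoetherianRing R] (S : Submonoid R)
    [CommRing L] [Algebra R L] [IsLocalization S L]
    [AddCommGroup Q] [Module R Q] [Module.Finite R Q] [AddCommGroup M] [Module R M]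
    [IsArtinian R M] : Function.Bijective (canMap R L Q M) := by
  obtain ⟨n, f, hf⟩ := Module.Finite.exists_fin' R Q
  obtain ⟨m, g, hg⟩ := Module.Finite.exists_fin' R (LinearMap.ker f)
  let g' : (Fin m → R) →ₗ[R] (Fin n → R) := (LinearMap.ker f).subtype ∘ₗ g
  have hex : Function.Exact g' f := by
    intro x
    constructor
    · intro hx
      obtain ⟨y, hy⟩ := hg ⟨x, hx⟩
      exact ⟨y, by simp [g', hy]⟩
    · rintro ⟨y, rfl⟩
      exact (g y).2
  have hart : ∀ k : ℕ, IsArtinian R ((Fin k → R) ⊗[R] M) := fun k => isArtinian_tensor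
  constructor
  · rw [injective_iff_map_eq_zero]
    intro x hx
    obtain ⟨y, rfl⟩ := LinearMap.rTensor_surjective _ hf x
    rw [canMap_naturality] at hx
    obtain ⟨z, hz⟩ := exists_lift_of_artinian S (g'.rTensor M) (canMap R L _ M y) (by
      intro l
      exact (rTensor_exact M hex hf _).1 (LinearMap.congr_fun hx l))
    obtain ⟨w, rfl⟩ := canMap_bijective_free.2 z
    have : g'.rTensor _ w = y := by
      apply canMap_bijective_free.1
      rw [canMap_naturality]
      exact LinearMap.ext hz
    rw [← this]
    exact (rTensor_exact _ hex hf _).2 ⟨w, rfl⟩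
  · intro h
    obtain ⟨z, hz⟩ := exists_lift_of_artinian S (f.rTensor M) h
      (fun l => LinearMap.rTensor_surjective M hf _)
    obtain ⟨w, rfl⟩ := canMap_bijective_free.2 z
    exact ⟨f.rTensor _ w, by rw [canMap_naturality]; exact LinearMap.ext hz⟩

theorem exists_colocalization_ne_zero {R X : Type u} [CommRing R] [AddCommGroup X] [Module R X]
    [IsArtinian R X] (x : X) (hx : x ≠ 0) : ∃ (m : Ideal R) (hm : m.IsMaximal),
      letI : m.IsPrime := hm.isPrime
      ∃ h : Localization.AtPrime m →ₗ[R] X, h ≠ 0 := by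
  have hnt : Nontrivial X := ⟨x, 0, hx⟩
  obtain ⟨N, hN⟩ := IsAtomic.exists_atom (Submodule R X)
  have hs : IsSimpleModule R N := isSimpleModule_iff_isAtom.2 hN
  obtain ⟨m, hm, ⟨e⟩⟩ := isSimpleModule_iff_quot_maximal.1 hs
  refine ⟨m, hm, ?_⟩
  have hp : m.IsPrime := hm.isPrime
  letI : Field (R ⧸ m) := Ideal.Quotient.field m
  let φ : Localization.AtPrime m →+* R ⧸ m :=
    IsLocalization.lift (M := m.primeCompl) (g := Ideal.Quotient.mk m) (fun y =>
      IsUnit.mk0 _ (fun h => y.2 (Ideal.Quotient.eq_zero_iff_mem.1 h)))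
  have hφ : ∀ r, φ (algebraMap R _ r) = Ideal.Quotient.mk m r := fun r => IsLocalization.lift_eq _ r
  let ψ : Localization.AtPrime m →ₗ[R] R ⧸ m :=
    { toFun := φ
      map_add' := map_add φ
      map_smul' := fun r y => by
        rw [Algebra.smul_def, map_mul, hφ]
        rfl }
  refine ⟨N.subtype ∘ₗ e.symm.toLinearMap ∘ₗ ψ, fun h => ?_⟩
  have h1 := LinearMap.congr_fun h 1
  have h2 : ψ 1 = 0 := by
    simpa using h1
  have h3 : φ 1 = 0 := h2
  rw [map_one] at h3
  exact one_ne_zero h3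

theorem TV_colocalization {R M : Type u} [CommRing R] [IsNoetherianRing R]
    [AddCommGroup M] [Module R M] [IsArtinian R M] (k : ℕ) (P : Type u) [AddCommGroup P]
    [Module R P] [Module.Finite R P] :
    TV R M k P ↔ ∀ m : {m : Ideal R // m.IsMaximal},
      letI : m.1.IsPrime := m.2.isPrime
      TV R (Localization.AtPrime m.1 →ₗ[R] M) k P := by
  induction k generalizing P with
  | zero =>
    constructor
    · intro h m G _ _ _ _ f hf
      have : m.1.IsPrime := m.2.isPrime
      have h1 := h G f hf
      rw [injective_iff_map_eq_zero]
      intro x hx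
      apply (canMap_bijective (R := R) (L := Localization.AtPrime m.1) m.1.primeCompl).1
      ext l
      apply h1
      have h2 := canMap_naturality (LinearMap.ker f).subtype x
      rw [hx, map_zero] at h2
      rw [← LinearMap.comp_apply, ← h2]
      simp
    · intro h G _ _ _ _ f hf
      by_contra hcon
      rw [injective_iff_map_eq_zero] at hcon
      push Not at hcon
      obtain ⟨x, hx, hx0⟩ := hcon
      let j := (LinearMap.ker f).subtype.rTensor M
      have : IsArtinian R (LinearMap.ker f ⊗[R] M) := isArtinian_tensor
      obtain ⟨m, hm, a, ha⟩ := exists_colocalization_ne_zero (R := R)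
        (⟨x, hx⟩ : LinearMap.ker j) (by simpa [Subtype.ext_iff] using hx0)
      have : m.IsPrime := hm.isPrime
      obtain ⟨y, hy⟩ := (canMap_bijective (R := R) (L := Localization.AtPrime m)
        m.primeCompl).2 ((LinearMap.ker j).subtype ∘ₗ a)
      have hy0 : y = 0 := by
        apply h ⟨m, hm⟩ G f hf
        apply canMap_bijective_free.1
        rw [canMap_naturality, hy]
        ext l
        simpa using (a l).2
      apply ha
      ext l
      have := LinearMap.congr_fun hy l
      rw [hy0] at this
      simpa using this.symm
  | succ k ih =>
    constructor
    · intro h m G _ _ _ _ f hf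
      exact (ih (LinearMap.ker f)).1 (h G f hf) m
    · intro h G _ _ _ _ f hf
      exact (ih (LinearMap.ker f)).2 (fun m => h m G f hf)

theorem TFD_colocalization {R M : Type u} [CommRing R] [IsNoetherianRing R]
    [AddCommGroup M] [Module R M] [IsArtinian R M] (k : ℕ) :
    TFD R M k ↔ ∀ m : {m : Ideal R // m.IsMaximal},
      letI : m.1.IsPrime := m.2.isPrime
      TFD R (Localization.AtPrime m.1 →ₗ[R] M) k :=
  ⟨fun h m P _ _ _ => (TV_colocalization k P).1 (h P) m,
    fun h P _ _ _ => (TV_colocalization k P).2 (fun m => h m P)⟩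

instance colocalization_isScalarTower {R M : Type*} [CommRing R] [AddCommGroup M] [Module R M]
    (p : Ideal R) [p.IsPrime] :
    IsScalarTower R (Localization.AtPrime p) (Localization.AtPrime p →ₗ[R] M) where
  smul_assoc r a f := LinearMap.ext fun y => by
    change f ((r • a) * y) = r • f (a * y)
    rw [smul_mul_assoc, map_smul]

end Colocalization


/-- Let `R` be a Noetherian ring and `M` an Artinian `R`-module. Then
`fd_R M = sup { fd_{R_m} Hom_R(R_m, M) | m ∈ Max R }`. -/
theorem flatDim_eq_iSup_flatDim_colocalization
    (R M : Type u) [CommRing R] [IsNoetherianRing R]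
    [AddCommGroup M] [Module R M] [IsArtinian R M] :
    flatDim R M
      = ⨆ m : {m : Ideal R // m.IsMaximal},
          letI : m.1.IsPrime := m.2.isPrime
          flatDim (Localization.AtPrime m.1) (Localization.AtPrime m.1 →ₗ[R] M) := by
  refine eq_of_forall_ge_iff fun c => ?_
  induction c using ENat.recTopCoe with
  | top => simp
  | coe k =>
    rw [flatDim_le_iff, TFD_colocalization, iSup_le_iff]
    refine forall_congr' fun m => ?_
    have : m.1.IsPrime := m.2.isPrime
    have : IsNoetherianRing (Localization.AtPrime m.1) :=
      IsLocalization.isNoetherianRing m.1.primeCompl _ inferInstance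
    rw [flatDim_le_iff]
    exact (TFD_iff_localization m.1.primeCompl (Localization.AtPrime m.1) k _).symm
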